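/- Let C be a dendritic face complex and let e, e' be two sources of a common face, i.e. e ≺⁻ a and e' ≺⁻ a for some a ∈ C. Then there is no non-trivial upper path from e to e': it is not the case that e <⁺ e'. -/

import Mathlib

/-- The signed codimension-1 face relation: `true` stands for `≺⁺`, `false` for `≺⁻`. -/
def sprec {α : Type*} (precN precP : α → α → Prop) : Bool → α → α → Prop
  | true => precP
  | false => precN

/-- A dendritic face complex (DFC) on a finite type `α` of faces: a positive-to-one
poset (graded by `dim`, with source relation `precN` = `≺⁻`, target relation
`precP` = `≺⁺`, and target map `tgt` = `γ`) together with a greatest element `top` = `ω`,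
oriented thinness (`thin`), and acyclicity (`src_singleton`, `src_exists`, `no_cycle`). -/
structure DFC (α : Type*) [Fintype α] where
  dim : α → ℕ
  precN : α → α → Prop
  precP : α → α → Prop
  tgt : α → α
  dim_precN : ∀ {y x}, precN y x → dim x = dim y + 1
  dim_precP : ∀ {y x}, precP y x → dim x = dim y + 1
  not_both : ∀ y x, ¬ (precN y x ∧ precP y x)
  tgt_precP : ∀ x, 1 ≤ dim x → precP (tgt x) x
  precP_unique : ∀ {y x}, precP y x → y = tgt x
  src_exists : ∀ x, 1 ≤ dim x → ∃ y, precN y x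
  top : α
  le_top : ∀ x, Relation.ReflTransGen (fun a b => precN a b ∨ precP a b) x top
  thin : ∀ (a b : Bool) (x y z : α), sprec precN precP b z y → sprec precN precP a y x →
    ∃! y', y' ≠ y ∧ ∃ a' b', sprec precN precP b' z y' ∧ sprec precN precP a' y' x ∧
      ((a = b) ↔ ¬ (a' = b'))
  src_singleton : ∀ x, dim x = 1 → ∃! y, precN y x
  no_cycle : ∀ (x : α) (p : ℕ), 1 ≤ p → ∀ y : ℕ → α,
    (∀ i, 1 ≤ i → i ≤ p → precN (y i) x) → y (p + 1) = y 1 →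
    ¬ (∀ i, 1 ≤ i → i ≤ p → precN (tgt (y (i + 1))) (y i))

namespace DFC

variable {α : Type*} [Fintype α]

/-- `x ◁ y` : there is `t` with `x ≺⁻ t` and `y ≺⁺ t`. -/
def tri (D : DFC α) (x y : α) : Prop := ∃ t, D.precN x t ∧ D.precP y t

/-- `<⁺` : the transitive closure of `◁`. -/
def ltP (D : DFC α) : α → α → Prop := Relation.TransGen D.tri

/-- The iterated target `γ^{(k)}ω ∈ C_k` (for `k ≤ n = dim ω`). -/
def itTgt (D : DFC α) (k : ℕ) : α := D.tgt^[D.dim D.top - k] D.top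

/-- Membership in `Λ_k` : a `k`-dimensional face that is the target of no face. -/
def lam (D : DFC α) (k : ℕ) (x : α) : Prop := D.dim x = k ∧ ∀ c, ¬ D.precP x c

/-- A (possibly trivial) lower path from `c` to `c'` inside `δ(b)`, all of whose
lower witnesses `dᵢ` have `e` as a `≺^β`-face: `c = c₀ ≻⁻ d₀ ≺⁺ c₁ ≻⁻ d₁ ≺⁺ ⋯ ≺⁺ c_p = c'`. -/
def lowerPath (D : DFC α) (β : Bool) (b e c c' : α) : Prop :=
  ∃ (p : ℕ) (cs ds : ℕ → α), cs 0 = c ∧ cs p = c' ∧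
    (∀ i ≤ p, D.precN (cs i) b) ∧
    ∀ i < p, D.precN (ds i) (cs i) ∧ D.precP (ds i) (cs (i + 1)) ∧
      sprec D.precN D.precP β e (ds i)

/-- A non-trivial simple `δ(b)`-zig-zag from `c` to `c'`: first `r` ascending steps
`cᵢ ≻⁺ dᵢ ≺⁻ c_{i+1}` with `e ≺^β dᵢ`, then `p − r` descending steps
`cᵢ ≻⁻ dᵢ ≺⁺ c_{i+1}` with `e ≺^{−β} dᵢ`, with pairwise distinct `dᵢ`. -/
def zigzag (D : DFC α) (β : Bool) (b e c c' : α) : Prop :=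
  ∃ (p r : ℕ), 1 ≤ p ∧ r ≤ p ∧ ∃ cs ds : ℕ → α,
    cs 0 = c ∧ cs p = c' ∧ (∀ i ≤ p, D.precN (cs i) b) ∧
    (∀ i j, i < p → j < p → i ≠ j → ds i ≠ ds j) ∧
    (∀ i < r, D.precP (ds i) (cs i) ∧ D.precN (ds i) (cs (i + 1)) ∧
      sprec D.precN D.precP β e (ds i)) ∧
    (∀ i, r ≤ i → i < p → D.precN (ds i) (cs i) ∧ D.precP (ds i) (cs (i + 1)) ∧
      sprec D.precN D.precP (!β) e (ds i))

end DFC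

namespace DFC

open Relation

set_option linter.unusedSectionVars false

variable {α : Type*} [Fintype α]

/-- signed face relation of `D` -/
abbrev sg (D : DFC α) (β : Bool) (x y : α) : Prop := sprec D.precN D.precP β x y

theorem sg_unique (D : DFC α) {a b : Bool} {x y : α} (h : D.sg a x y) (h' : D.sg b x y) :
    a = b := by
  cases a <;> cases b
  · rfl
  · exact absurd ⟨h, h'⟩ (D.not_both x y)
  · exact absurd ⟨h', h⟩ (D.not_both x y)
  · rfl

theorem sg_dim (D : DFC α) {a : Bool} {x y : α} (h : D.sg a x y) : D.dim y = D.dim x + 1 := by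
  cases a
  · exact D.dim_precN h
  · exact D.dim_precP h

theorem precP_inj (D : DFC α) {x y z : α} (h : D.precP x z) (h' : D.precP y z) : x = y :=
  (D.precP_unique h).trans (D.precP_unique h').symm

theorem thin_ex (D : DFC α) {a b : Bool} {x y z : α} (h : D.sg b z y) (h' : D.sg a y x) :
    ∃ y' a' b', y' ≠ y ∧ D.sg b' z y' ∧ D.sg a' y' x ∧ ((a = b) ↔ ¬ (a' = b')) := by
  obtain ⟨y', ⟨h1, a', b', h2, h3, h4⟩, -⟩ := D.thin a b x y z h h'
  exact ⟨y', a', b', h1, h2, h3, h4⟩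

theorem thin_uniq (D : DFC α) {a b a' b' : Bool} {x y y' z : α} (h : D.sg b z y)
    (h' : D.sg a y x) (k : D.sg b' z y') (k' : D.sg a' y' x) (hs : (a = b) ↔ (a' = b')) :
    y = y' := by
  obtain ⟨y2, a2, b2, h1, h2, h3, h4⟩ := D.thin_ex h h'
  refine (D.thin a2 b2 x y2 z h2 h3).unique ⟨h1.symm, a, b, h, h', ?_⟩ ⟨?_, a', b', k, k', ?_⟩
  · tauto
  · rintro rfl
    have e1 := D.sg_unique h2 k
    have e2 := D.sg_unique h3 k'
    subst e1 e2
    tauto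
  · tauto

/-- `x` is an inner codimension 2 face of `c` -/
def Inn (D : DFC α) (x c : α) : Prop :=
  ∃ d d', D.precN d c ∧ D.precN d' c ∧ D.precP x d ∧ D.precN x d'

theorem src_uniq (D : DFC α) {β : Bool} {x y y' z : α} (h : D.sg β z y) (h' : D.sg β z y')
    (k : D.precN y x) (k' : D.precN y' x) : y = y' :=
  D.thin_uniq (a := false) (a' := false) h k h' k' Iff.rfl

theorem not_inn (D : DFC α) {β : Bool} {x c g : α} (h : D.sg β x g) (hg : D.precP g c) :
    ¬ D.Inn x c := by
  rintro ⟨d, d', h1, h2, h3, h4⟩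
  cases β
  · have := D.thin_uniq (a := true) (b := false) (a' := false) (b' := true) h hg h3 h1 (by simp)
    subst this
    exact D.not_both _ _ ⟨h1, hg⟩
  · have := D.thin_uniq (a := true) (b := true) (a' := false) (b' := false) h hg h4 h2 (by simp)
    subst this
    exact D.not_both _ _ ⟨h2, hg⟩

theorem step_up (D : DFC α) {β : Bool} {x s c g : α} (h : D.sg β x s) (hs : D.precN s c)
    (hg : D.precP g c) : D.sg β x g ∨ D.Inn x c := by
  obtain ⟨y', a', b', h1, h2, h3, h4⟩ := D.thin_ex (a := false) h hs
  cases a'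
  · right
    cases β <;> cases b' <;> simp at h4
    · exact ⟨y', s, h3, hs, h2, h⟩
    · exact ⟨s, y', hs, h3, h, h2⟩
  · left
    have : y' = g := D.precP_inj h3 hg
    subst this
    cases β <;> cases b' <;> simp at h4
    · exact h2
    · exact h2

theorem step_down (D : DFC α) {β : Bool} {x c g : α} (h : D.sg β x g) (hg : D.precP g c) :
    ∃ s, D.precN s c ∧ D.sg β x s := by
  obtain ⟨y', a', b', h1, h2, h3, h4⟩ := D.thin_ex (a := true) h hg
  cases a'
  · refine ⟨y', h3, ?_⟩
    cases β <;> cases b' <;> simp at h4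
    · exact h2
    · exact h2
  · exact absurd (D.precP_inj h3 hg) h1

/-- tree edges between sources of `b` -/
def E (D : DFC α) (b c' c : α) : Prop :=
  D.precN c' b ∧ D.precN c b ∧ ∃ d, D.precP d c' ∧ D.precN d c

theorem tmono {R S : α → α → Prop} {a b : α} (h : TransGen R a b)
    (hRS : ∀ x y, R x y → S x y) : TransGen S a b := by
  induction h with
  | single h => exact .single (hRS _ _ h)
  | tail _ h ih => exact ih.tail (hRS _ _ h)

theorem rmono {R S : α → α → Prop} {a b : α} (h : ReflTransGen R a b)
    (hRS : ∀ x y, R x y → S x y) : ReflTransGen S a b := by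
  induction h with
  | refl => exact .refl
  | tail _ h ih => exact ih.tail (hRS _ _ h)

theorem exists_seq {R : α → α → Prop} {a b : α} (h : TransGen R a b) :
    ∃ (p : ℕ) (y : ℕ → α), 1 ≤ p ∧ y 1 = b ∧ y (p + 1) = a ∧
      ∀ i, 1 ≤ i → i ≤ p → R (y (i + 1)) (y i) := by
  induction h using TransGen.head_induction_on with
  | @single a h =>
    refine ⟨1, fun i => if i = 1 then b else a, le_rfl, by simp, by simp, ?_⟩
    intro i h1 h2
    have : i = 1 := by omega
    subst this
    simpa using h
  | @head a c h _ ih =>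
    obtain ⟨p, y, hp, hb, hc, hy⟩ := ih
    refine ⟨p + 1, fun i => if i = p + 2 then a else y i, by omega, ?_, by simp, ?_⟩
    · have : (1 : ℕ) ≠ p + 2 := by omega
      simp [hb]
    · intro i h1 h2
      rcases Nat.lt_or_ge i (p + 1) with h3 | h3
      · have e1 : i + 1 ≠ p + 2 := by omega
        have e2 : i ≠ p + 2 := by omega
        simp only [e1, e2, if_false]
        exact hy i h1 (by omega)
      · have : i = p + 1 := by omega
        subst this
        simpa [hc] using h

theorem E_acyclic (D : DFC α) (b c : α) : ¬ TransGen (D.E b) c c := by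
  intro h
  obtain ⟨p, y, hp, h1, h2, h3⟩ := exists_seq h
  refine D.no_cycle b p hp y (fun i hi hi' => (h3 i hi hi').2.1) (h2.trans h1.symm) ?_
  intro i hi hi'
  obtain ⟨-, -, d, hd, hd'⟩ := h3 i hi hi'
  rwa [← D.precP_unique hd]

theorem wf_of_acyclic {R : α → α → Prop} (h : ∀ x, ¬ TransGen R x x) : WellFounded R := by
  have h1 : IsTrans α (TransGen R) := ⟨fun _ _ _ => TransGen.trans⟩
  have h2 : Std.Irrefl (TransGen R) := ⟨h⟩
  have := Finite.wellFounded_of_trans_of_irrefl (TransGen R)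
  exact Subrelation.wf (fun h => TransGen.single h) this

/-- tree edges with a fixed face -/
def Ex (D : DFC α) (β : Bool) (x b c' c : α) : Prop :=
  D.precN c' b ∧ D.precN c b ∧ ∃ d, D.precP d c' ∧ D.precN d c ∧ D.sg β x d

theorem descend (D : DFC α) {β : Bool} {x b g : α} (hg : D.precP g b) (c : α) :
    ∀ d, D.precN c b → D.precN d c → D.sg β x d →
    ∃ c0 d0, D.precN d0 g ∧ D.precN d0 c0 ∧ D.sg β x d0 ∧ D.precN c0 b ∧
      ReflTransGen (D.Ex β x b) c0 c := by
  induction c using (wf_of_acyclic (D.E_acyclic b)).induction with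
  | _ c ih =>
    intro d hc hd hx
    rcases D.step_up (β := false) hd hc hg with h | ⟨c', c'', h1, h2, h3, h4⟩
    · exact ⟨c, d, h, hd, hx, hc, .refl⟩
    · obtain ⟨d', hd', hx'⟩ := D.step_down hx h3
      obtain ⟨c0, d0, k1, k2, k3, k4, k5⟩ := ih c' ⟨h1, hc, d, h3, hd⟩ d' h1 hd' hx'
      exact ⟨c0, d0, k1, k2, k3, k4, k5.tail ⟨h1, hc, d, h3, hd, hx⟩⟩

theorem inn_up (D : DFC α) {x b c g : α} (hg : D.precP g b) (hc : D.precN c b)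
    (h : D.Inn x c) : D.Inn x g := by
  obtain ⟨d, d', h1, h2, h3, h4⟩ := h
  obtain ⟨c0, d0, k1, -, k3, -⟩ := D.descend (β := true) hg c d hc h1 h3
  obtain ⟨c0', d0', l1, -, l3, -⟩ := D.descend (β := false) hg c d' hc h2 h4
  exact ⟨d0, d0', k1, l1, k3, l3⟩

theorem inn_ex_absurd (D : DFC α) {β : Bool} {x b c c' : α} (h : D.Inn x c)
    (h' : ReflTransGen (D.Ex β x b) c c') : c = c' := by
  rcases h'.cases_head with h1 | ⟨c1, ⟨-, -, d, h2, -, h3⟩, -⟩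
  · exact h1
  · exact absurd h (D.not_inn h3 h2)

theorem inn_src_uniq (D : DFC α) {x b c c' g : α} (hg : D.precP g b) (hc : D.precN c b)
    (hc' : D.precN c' b) (h : D.Inn x c) (h' : D.Inn x c') : c = c' := by
  have hI := h
  have hI' := h'
  obtain ⟨d, -, h1, -, h3, -⟩ := h
  obtain ⟨d', -, h1', -, h3', -⟩ := h'
  obtain ⟨c0, d0, k1, k2, k3, k4, k5⟩ := D.descend (β := true) hg c d hc h1 h3
  obtain ⟨c0', d0', l1, l2, l3, l4, l5⟩ := D.descend (β := true) hg c' d' hc' h1' h3'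
  have e1 : d0 = d0' := D.src_uniq k3 l3 k1 l1
  subst e1
  have e2 : c0 = c0' := D.src_uniq (β := false) k2 l2 k4 l4
  subst e2
  have hru : Relator.RightUnique (D.Ex true x b) := by
    rintro u v w ⟨-, hv, e, he, hev, -⟩ ⟨-, hw, e', he', hew, -⟩
    have := D.precP_inj he he'
    subst this
    exact D.src_uniq (β := false) hev hew hv hw
  rcases ReflTransGen.total_of_right_unique hru k5 l5 with h | h
  · exact D.inn_ex_absurd hI h
  · exact (D.inn_ex_absurd hI' h).symm

def isL (D : DFC α) (c : α) : Prop := ∀ t, ¬ D.precP c t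

/-- parent relation -/
def par (D : DFC α) (x y : α) : Prop := ∃ c, D.isL c ∧ D.precN x c ∧ D.precP y c

theorem par_dim (D : DFC α) {x y : α} (h : D.par x y) : D.dim x = D.dim y := by
  obtain ⟨c, -, h1, h2⟩ := h
  have := D.dim_precN h1
  have := D.dim_precP h2
  omega

theorem pars_dim (D : DFC α) {x y : α} (h : ReflTransGen D.par x y) : D.dim x = D.dim y := by
  induction h with
  | refl => rfl
  | tail _ h ih => exact ih.trans (D.par_dim h)

theorem par_tri (D : DFC α) {x y : α} (h : D.par x y) : D.tri x y := by
  obtain ⟨c, -, h1, h2⟩ := h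
  exact ⟨c, h1, h2⟩

theorem back_total {R : α → α → Prop} (hR : ∀ a b c, R a c → R b c → a = b) {a b u : α}
    (ha : ReflTransGen R a u) (hb : ReflTransGen R b u) :
    ReflTransGen R a b ∨ ReflTransGen R b a := by
  have hru : Relator.RightUnique (Function.swap R) := fun c a b h h' => hR a b c h h'
  rcases ReflTransGen.total_of_right_unique hru (reflTransGen_swap.mpr ha)
    (reflTransGen_swap.mpr hb) with h | h
  · exact Or.inr (reflTransGen_swap.mp h)
  · exact Or.inl (reflTransGen_swap.mp h)

theorem dim_le (D : DFC α) (x : α) : D.dim x ≤ D.dim D.top := by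
  have h := D.le_top x
  induction h using ReflTransGen.head_induction_on with
  | refl => rfl
  | head h _ ih =>
    rcases h with h | h
    · have := D.dim_precN h
      omega
    · have := D.dim_precP h
      omega

theorem itTgt_dim (D : DFC α) (j : ℕ) : ∀ k, k + j = D.dim D.top → D.dim (D.itTgt k) = k := by
  induction j with
  | zero =>
    intro k hk
    have : D.dim D.top - k = 0 := by omega
    simp [itTgt, this]
    omega
  | succ j ih =>
    intro k hk
    have h1 := ih (k + 1) (by omega)
    have e : D.dim D.top - k = (D.dim D.top - (k + 1)) + 1 := by omega
    have h2 : D.itTgt k = D.tgt (D.itTgt (k + 1)) := by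
      unfold itTgt
      rw [e, Function.iterate_succ_apply']
    have h3 := D.dim_precP (D.tgt_precP (D.itTgt (k + 1)) (by omega))
    rw [h2]
    omega

theorem itTgt_precP (D : DFC α) {k : ℕ} (hk : k + 1 ≤ D.dim D.top) :
    D.precP (D.itTgt k) (D.itTgt (k + 1)) := by
  have h1 := D.itTgt_dim (D.dim D.top - (k + 1)) (k + 1) (by omega)
  have e : D.dim D.top - k = (D.dim D.top - (k + 1)) + 1 := by omega
  have h2 : D.itTgt k = D.tgt (D.itTgt (k + 1)) := by
    unfold itTgt
    rw [e, Function.iterate_succ_apply']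
  rw [h2]
  exact D.tgt_precP _ (by omega)

/-- the inductive package at level `k` -/
structure Phi (D : DFC α) (k : ℕ) : Prop where
  comp : ∀ (β : Bool) (x c c' : α), D.dim x = k → D.sg β x c → D.sg β x c' →
    ReflTransGen D.par c c' ∨ ReflTransGen D.par c' c
  reach : ∀ x, D.dim x = k → ReflTransGen D.par x (D.itTgt k)
  nopath : ∀ a e e', D.dim e = k → D.precN e a → D.precN e' a → ¬ D.ltP e e'

theorem isL_of_pars (D : DFC α) {c c' : α} (h : ReflTransGen D.par c c') (hL : D.isL c') :
    c = c' := by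
  rcases h.cases_tail with h | ⟨y, -, b, -, -, h⟩
  · exact h.symm
  · exact absurd h (hL b)

theorem Phi.uniq {D : DFC α} {k : ℕ} (P : D.Phi k) {β : Bool} {x c c' : α} (hx : D.dim x = k)
    (h : D.sg β x c) (h' : D.sg β x c') (hL : D.isL c) (hL' : D.isL c') : c = c' := by
  rcases P.comp β x c c' hx h h' with h | h
  · exact D.isL_of_pars h hL'
  · exact (D.isL_of_pars h hL).symm

theorem Phi.par_ru {D : DFC α} {k : ℕ} (P : D.Phi k) {x y z : α} (hx : D.dim x = k)
    (h : D.par x y) (h' : D.par x z) : y = z := by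
  obtain ⟨c, hc, h1, h2⟩ := h
  obtain ⟨c', hc', h1', h2'⟩ := h'
  have := P.uniq (β := false) hx h1 h1' hc hc'
  subst this
  exact D.precP_inj h2 h2'

theorem Phi.linear {D : DFC α} {k : ℕ} (P : D.Phi k) {x y z : α} (hx : D.dim x = k)
    (h : ReflTransGen D.par x y) (h' : ReflTransGen D.par x z) :
    ReflTransGen D.par y z ∨ ReflTransGen D.par z y := by
  induction h with
  | refl => exact Or.inl h'
  | @tail u v hu hv ih =>
    rcases ih with ih | ih
    · rcases ih.cases_head with h1 | ⟨w, h1, h2⟩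
      · subst h1
        exact Or.inr (.single hv)
      · have := P.par_ru ((D.pars_dim hu).symm.trans hx) hv h1
        subst this
        exact Or.inl h2
    · exact Or.inr (ih.tail hv)

theorem Phi.acyclic {D : DFC α} {k : ℕ} (P : D.Phi k) {x : α} (hx : D.dim x = k) :
    ¬ D.ltP x x := by
  intro h
  obtain ⟨y, ⟨t, h1, -⟩, -⟩ := (TransGen.head'_iff).mp h
  exact P.nopath t x x hx h1 h1 h

theorem tri_dim (D : DFC α) {x y : α} (h : D.tri x y) : D.dim x = D.dim y := by
  obtain ⟨c, h1, h2⟩ := h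
  have := D.dim_precN h1
  have := D.dim_precP h2
  omega

theorem wf_tri (D : DFC α) {k : ℕ} (h : ∀ x, D.dim x = k → ¬ D.ltP x x) :
    WellFounded (fun x y => D.dim x = k ∧ D.tri x y) := by
  apply wf_of_acyclic
  intro x hx
  have h1 : D.dim x = k := by
    obtain ⟨y, h, -⟩ := (TransGen.head'_iff).mp hx
    exact h.1
  exact h x h1 (tmono hx (fun _ _ h => h.2))

theorem wf_tri' (D : DFC α) {k : ℕ} (h : ∀ x, D.dim x = k → ¬ D.ltP x x) :
    WellFounded (fun y x => D.dim x = k ∧ D.tri x y) := by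
  apply wf_of_acyclic
  intro x hx
  have hx' := transGen_swap.mp hx
  have h1 : D.dim x = k := by
    obtain ⟨y, h, -⟩ := (TransGen.head'_iff).mp hx'
    exact h.1
  exact h x h1 (tmono hx' (fun _ _ h => h.2))

theorem inn_pars (D : DFC α) {x y z : α} (hy : D.Inn x y) (h : ReflTransGen D.par y z) :
    ReflTransGen (fun u v => D.Inn x u ∧ D.par u v) y z ∧ D.Inn x z := by
  induction h with
  | refl => exact ⟨.refl, hy⟩
  | tail _ h ih =>
    refine ⟨ih.1.tail ⟨ih.2, h⟩, ?_⟩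
    obtain ⟨b, -, h1, h2⟩ := h
    exact D.inn_up h2 h1 ih.2

theorem inn_dim (D : DFC α) {x c : α} (h : D.Inn x c) : D.dim c = D.dim x + 2 := by
  obtain ⟨d, -, h1, -, h2, -⟩ := h
  have := D.dim_precN h1
  have := D.dim_precP h2
  omega

theorem inn_uniq (D : DFC α) {m : ℕ} (P : D.Phi (m + 2)) {x c c' : α} (hx : D.dim x = m)
    (h : D.Inn x c) (h' : D.Inn x c') (hL : D.isL c) (hL' : D.isL c') : c = c' := by
  have hd := D.inn_dim h
  have hd' := D.inn_dim h'
  have k := (D.inn_pars h (P.reach c (by omega))).1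
  have k' := (D.inn_pars h' (P.reach c' (by omega))).1
  have hb : ∀ a b u, (D.Inn x a ∧ D.par a u) → (D.Inn x b ∧ D.par b u) → a = b := by
    rintro a b u ⟨ha, s, hs, h1, h2⟩ ⟨hb, s', hs', h1', h2'⟩
    have hu : D.dim u = m + 2 := by
      have := D.inn_dim ha
      have := D.dim_precN h1
      have := D.dim_precP h2
      omega
    have := P.uniq (β := true) hu h2 h2' hs hs'
    subst this
    exact D.inn_src_uniq h2 h1 h1' ha hb
  rcases back_total hb k k' with h | h
  · exact D.isL_of_pars (rmono h (fun _ _ h => h.2)) hL'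
  · exact (D.isL_of_pars (rmono h (fun _ _ h => h.2)) hL).symm

/-- climbing while keeping `x` as a `β`-face -/
def clim (D : DFC α) (β : Bool) (x y z : α) : Prop := D.sg β x y ∧ D.par y z

theorem climb (D : DFC α) {β : Bool} {x s t : α} (h : ReflTransGen D.par s t)
    (hs : D.sg β x s) :
    ∃ u, ReflTransGen (D.clim β x) s u ∧ D.sg β x u ∧
      (u = t ∨ ∃ c, D.isL c ∧ D.precN u c ∧ D.Inn x c) := by
  induction h using ReflTransGen.head_induction_on with
  | refl => exact ⟨t, .refl, hs, Or.inl rfl⟩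
  | @head a b h _ ih =>
    have hp := h
    obtain ⟨c, hc, h1, h2⟩ := h
    rcases D.step_up hs h1 h2 with h3 | h3
    · obtain ⟨u, k1, k2, k3⟩ := ih h3
      exact ⟨u, k1.head ⟨hs, hp⟩, k2, k3⟩
    · exact ⟨a, .refl, hs, Or.inr ⟨c, hc, h1, h3⟩⟩

theorem no_top_inn (D : DFC α) {m : ℕ} (P : D.Phi (m + 2)) {β : Bool} {x c : α}
    (hx : D.dim x = m) (h : D.sg β x (D.itTgt (m + 1))) (hc : D.Inn x c) : False := by
  have hd := D.inn_dim hc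
  have hle := D.dim_le c
  have h1 := (D.inn_pars hc (P.reach c (by omega))).2
  exact D.not_inn h (D.itTgt_precP (by omega)) h1

theorem comp_step (D : DFC α) {m : ℕ} (P1 : D.Phi (m + 1)) (P2 : D.Phi (m + 2))
    (β : Bool) (x c c' : α) (hx : D.dim x = m) (h : D.sg β x c) (h' : D.sg β x c') :
    ReflTransGen D.par c c' ∨ ReflTransGen D.par c' c := by
  have hd := D.sg_dim h
  have hd' := D.sg_dim h'
  obtain ⟨u, k1, k2, k3⟩ := D.climb (P1.reach c (by omega)) h
  obtain ⟨u', k1', k2', k3'⟩ := D.climb (P1.reach c' (by omega)) h'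
  have hu : u = u' := by
    rcases k3 with rfl | ⟨a, a1, a2, a3⟩ <;> rcases k3' with rfl | ⟨b, b1, b2, b3⟩
    · rfl
    · exact (D.no_top_inn P2 hx k2 b3).elim
    · exact (D.no_top_inn P2 hx k2' a3).elim
    · have := D.inn_uniq P2 hx a3 b3 a1 b1
      subst this
      exact D.src_uniq k2 k2' a2 b2
  subst hu
  have hb : ∀ a b u, D.clim β x a u → D.clim β x b u → a = b := by
    rintro a b u ⟨ha, s, hs, h1, h2⟩ ⟨hb, s', hs', h1', h2'⟩
    have hu : D.dim u = m + 1 := by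
      have := D.sg_dim ha
      have := D.dim_precN h1
      have := D.dim_precP h2
      omega
    have := P1.uniq (β := true) hu h2 h2' hs hs'
    subst this
    exact D.src_uniq ha hb h1 h1'
  rcases back_total hb k1 k1' with h | h
  · exact Or.inl (rmono h (fun _ _ h => h.2))
  · exact Or.inr (rmono h (fun _ _ h => h.2))

/-- lower adjacency -/
def Adj (D : DFC α) (m : ℕ) (t t' : α) : Prop := ∃ x, D.dim x = m ∧ D.precP x t ∧ D.precN x t'

def Sep (D : DFC α) (t t' : α) : Prop :=
  ∃ c r r', D.isL c ∧ D.precN r c ∧ D.precN r' c ∧ ReflTransGen D.par t r ∧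
    ReflTransGen D.par t' r' ∧ TransGen (D.E c) r r'

theorem adj_sep (D : DFC α) {m : ℕ} (P1 : D.Phi (m + 1)) (P2 : D.Phi (m + 2)) {t t' : α}
    (h : D.Adj m t t') : D.Sep t t' := by
  obtain ⟨x, hx, h1, h2⟩ := h
  have hd := D.dim_precP h1
  have hd' := D.dim_precN h2
  obtain ⟨u, k1, k2, k3⟩ := D.climb (β := true) (P1.reach t (by omega)) h1
  obtain ⟨u', k1', k2', k3'⟩ := D.climb (β := false) (P1.reach t' (by omega)) h2
  rcases k3 with rfl | ⟨a, a1, a2, a3⟩ <;> rcases k3' with rfl | ⟨b, b1, b2, b3⟩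
  · exact (D.not_both _ _ ⟨k2', k2⟩).elim
  · exact (D.no_top_inn P2 hx k2 b3).elim
  · exact (D.no_top_inn P2 hx k2' a3).elim
  · have := D.inn_uniq P2 hx a3 b3 a1 b1
    subst this
    exact ⟨a, u, u', a1, a2, b2, rmono k1 (fun _ _ h => h.2), rmono k1' (fun _ _ h => h.2),
      .single ⟨a2, b2, x, k2, k2'⟩⟩

theorem up_through (D : DFC α) {k : ℕ} (P : D.Phi k) {r c s : α} (hr : D.dim r = k)
    (hc : D.isL c) (hrc : D.precN r c) (h : ReflTransGen D.par r s) (hne : r ≠ s) :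
    ∃ g, D.precP g c ∧ ReflTransGen D.par g s := by
  rcases h.cases_head with h1 | ⟨y, h1, h2⟩
  · exact absurd h1 hne
  · have hg := D.tgt_precP c (by have := D.dim_precN hrc; omega)
    have : y = D.tgt c := P.par_ru hr h1 ⟨c, hc, hrc, hg⟩
    subst this
    exact ⟨_, hg, h2⟩

theorem sep_trans (D : DFC α) {k : ℕ} (P : D.Phi k) {t t' t'' : α} (ht : D.dim t' = k)
    (h : D.Sep t t') (h' : D.Sep t' t'') : D.Sep t t'' := by
  obtain ⟨c, r, r', a1, a2, a3, a4, a5, a6⟩ := h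
  obtain ⟨d, s, s', b1, b2, b3, b4, b5, b6⟩ := h'
  have hr' : D.dim r' = k := by rw [← D.pars_dim a5, ht]
  have hs : D.dim s = k := by rw [← D.pars_dim b4, ht]
  by_cases hne : r' = s
  · subst hne
    have := P.uniq (β := false) hr' a3 b2 a1 b1
    subst this
    exact ⟨c, r, s', a1, a2, b3, a4, b5, a6.trans b6⟩
  rcases P.linear ht a5 b4 with h | h
  · obtain ⟨g, hg, hgs⟩ := D.up_through P hr' a1 a3 h hne
    exact ⟨d, s, s', b1, b2, b3, (a4.tail ⟨c, a1, a2, hg⟩).trans hgs, b5, b6⟩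
  · obtain ⟨g, hg, hgs⟩ := D.up_through P hs b1 b2 h (Ne.symm hne)
    exact ⟨c, r, r', a1, a2, a3, a4, (b5.tail ⟨d, b1, b3, hg⟩).trans hgs, a6⟩

theorem ltP_adj (D : DFC α) {m : ℕ} {e e' a : α} (he : D.dim e = m) (h : D.ltP e e')
    (ha : D.precN e' a) : ∃ t, D.precN e t ∧ TransGen (D.Adj m) t a := by
  unfold ltP at h
  induction h using TransGen.head_induction_on with
  | @single e h =>
    have hd := D.tri_dim h
    obtain ⟨t, h1, h2⟩ := h
    exact ⟨t, h1, .single ⟨e', by omega, h2, ha⟩⟩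
  | @head e c h _ ih =>
    have hd := D.tri_dim h
    obtain ⟨t1, k1, k2⟩ := ih (by omega)
    obtain ⟨t, h1, h2⟩ := h
    exact ⟨t, h1, k2.head ⟨c, by omega, h2, k1⟩⟩

theorem adjs_sep (D : DFC α) {m : ℕ} (P1 : D.Phi (m + 1)) (P2 : D.Phi (m + 2)) {t t' : α}
    (h : TransGen (D.Adj m) t t') : D.Sep t t' := by
  induction h with
  | single h => exact D.adj_sep P1 P2 h
  | tail _ h ih =>
    have h' := h
    obtain ⟨x, hx, h1, -⟩ := h'
    exact D.sep_trans P1 (by have := D.dim_precP h1; omega) ih (D.adj_sep P1 P2 h)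

theorem src_incomp (D : DFC α) {k : ℕ} (P : D.Phi k) {c r r' : α} (hr : D.dim r = k)
    (h : D.precN r c) (h' : D.precN r' c) (hp : ReflTransGen D.par r r') : r = r' := by
  rcases reflTransGen_iff_eq_or_transGen.mp hp with h1 | h1
  · exact h1.symm
  · exact absurd (tmono h1 (fun _ _ => D.par_tri)) (P.nopath c r r' hr h h')

theorem nopath_step (D : DFC α) {m : ℕ} (P1 : D.Phi (m + 1)) (P2 : D.Phi (m + 2))
    (a e e' : α) (hm : D.dim e = m) (he : D.precN e a) (he' : D.precN e' a) :
    ¬ D.ltP e e' := by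
  intro h
  obtain ⟨t, ht, hta⟩ := D.ltP_adj hm h he'
  obtain ⟨c, r, r', a1, a2, a3, a4, a5, a6⟩ := D.adjs_sep P1 P2 hta
  have hdt := D.dim_precN ht
  have hda := D.dim_precN he
  have hr := D.pars_dim a4
  have hr' := D.pars_dim a5
  have hlin : ReflTransGen D.par r r' ∨ ReflTransGen D.par r' r := by
    rcases D.comp_step P1 P2 false e t a hm ht he with h | h
    · exact P1.linear (by omega) a4 (h.trans a5)
    · exact P1.linear (by omega) (h.trans a4) a5
  have heq : r = r' := by
    rcases hlin with h | h
    · exact D.src_incomp P1 (by omega) a2 a3 h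
    · exact (D.src_incomp P1 (by omega) a3 a2 h).symm
  subst heq
  exact D.E_acyclic c r a6

theorem exists_src (D : DFC α) {m : ℕ} (P1 : D.Phi (m + 1)) {x : α} (hx : D.dim x = m)
    (hne : x ≠ D.itTgt m) : ∃ t, D.precN x t := by
  rcases (D.le_top x).cases_head with h | ⟨t, h | h, -⟩
  · exfalso
    apply hne
    subst hx
    rw [h]
    simp [itTgt]
  · exact ⟨t, h⟩
  · have hd := D.dim_precP h
    have hr := P1.reach t (by omega)
    have hle := D.dim_le t
    induction hr using ReflTransGen.head_induction_on with
    | refl => exact absurd (D.precP_inj h (D.itTgt_precP (by omega))) hne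
    | @head t t' hp _ ih =>
      have hpd := D.par_dim hp
      obtain ⟨c, hc, h1, h2⟩ := hp
      rcases D.step_up (β := true) h h1 h2 with h3 | ⟨d, d', -, -, -, h3⟩
      · exact ih h3 (by omega) (by omega)
      · exact ⟨d', h3⟩

theorem exists_srcL (D : DFC α) {m : ℕ} (P1 : D.Phi (m + 1)) {x : α} (hx : D.dim x = m)
    (t : α) : D.precN x t → ∃ t, D.isL t ∧ D.precN x t := by
  induction t using (D.wf_tri (k := m + 1) (fun _ h => P1.acyclic h)).induction with
  | _ t ih =>
    intro h
    by_cases hL : D.isL t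
    · exact ⟨t, hL, h⟩
    · unfold isL at hL
      push Not at hL
      obtain ⟨c, hc⟩ := hL
      obtain ⟨s, hs, hxs⟩ := D.step_down (β := false) h hc
      have hd := D.sg_dim hxs
      exact ih s ⟨by omega, c, hs, hc⟩ hxs

theorem phi_step (D : DFC α) {m : ℕ} (P1 : D.Phi (m + 1)) (P2 : D.Phi (m + 2)) :
    D.Phi m := by
  have hnp := D.nopath_step P1 P2
  refine ⟨D.comp_step P1 P2, ?_, hnp⟩
  have hac : ∀ x, D.dim x = m → ¬ D.ltP x x := by
    intro x hx h
    obtain ⟨y, ⟨t, h1, -⟩, -⟩ := (TransGen.head'_iff).mp h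
    exact hnp t x x hx h1 h1 h
  intro x
  induction x using (D.wf_tri' hac).induction with
  | _ x ih =>
    intro hx
    by_cases hne : x = D.itTgt m
    · rw [← hne]
    · obtain ⟨t, ht⟩ := D.exists_src P1 hx hne
      obtain ⟨c, hc, hxc⟩ := D.exists_srcL P1 hx t ht
      have hd := D.dim_precN hxc
      have hp : D.par x (D.tgt c) := ⟨c, hc, hxc, D.tgt_precP c (by omega)⟩
      exact (ih _ ⟨hx, D.par_tri hp⟩ ((D.par_dim hp).symm.trans hx)).head hp

theorem phi_all (D : DFC α) (j : ℕ) : ∀ k, D.dim D.top < k + j → D.Phi k := by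
  induction j with
  | zero =>
    intro k hk
    have h0 : ∀ x, D.dim x ≠ k := fun x hx => by have := D.dim_le x; omega
    exact ⟨fun _ x _ _ hx => absurd hx (h0 x), fun x hx => absurd hx (h0 x),
      fun _ e _ hx => absurd hx (h0 e)⟩
  | succ j ih =>
    intro k hk
    exact D.phi_step (ih (k + 1) (by omega)) (ih (k + 2) (by omega))

end DFC

/-- there is no non-trivial upper path between two sources of a
common face: if `e ≺⁻ a` and `e' ≺⁻ a` then `¬ (e <⁺ e')`. -/
theorem dfc_no_upper_path_between_sources {α : Type*} [Fintype α] (D : DFC α)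
    (a e e' : α) (he : D.precN e a) (he' : D.precN e' a) :
    ¬ D.ltP e e' := by
  exact (D.phi_all (D.dim D.top + 1) (D.dim e) (by omega)).nopath a e e' rfl he he'
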